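/- arXiv:1710.09795 — 2 statements merged into one kernel-verified Lean document; each statement's English description precedes it below -/
import Mathlib

section
/- There exists a constant K > 0 such that for every ε with 0 < ε < 1/K and every positive integer n, there exists a (K/ε)-long-distance ε-synchronization string of length n over an alphabet of size at most K·ε⁻⁴. -/
/-- Length of a longest common subsequence of `a` and `b`. -/
def lcsLen {α : Type*} [DecidableEq α] (a b : List α) : ℕ :=
  ((a.sublists.filter (fun c => decide (c.Sublist b))).map List.length).foldr max 0

/-- Edit distance: the minimum number of single-symbol insertions and deletions
transforming one string into the other, via `ED a b = |a| + |b| - 2·LCS(a,b)`. -/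
def ED {α : Type*} [DecidableEq α] (a b : List α) : ℕ :=
  a.length + b.length - 2 * lcsLen a b

/-- `substr S i j` is the substring `S[i,j)` from 1-based position `i` (inclusive)
to position `j` (exclusive). -/
def substr {α : Type*} (S : List α) (i j : ℕ) : List α :=
  (S.drop (i - 1)).take (j - i)


/-- `S` is a `c`-long-distance `ε`-synchronization string: for all
`1 ≤ i < j ≤ i' < j' ≤ |S| + 1` such that either `i' = j` (adjacent intervals) or the
total length exceeds `c·log₂ |S|`, the edit distance of `S[i,j)` and `S[i',j')`
exceeds `(1-ε)` times the total length. -/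
def LongDistSync {α : Type*} [DecidableEq α] (c ε : ℝ) (S : List α) : Prop :=
  ∀ i j i' j' : ℕ, 1 ≤ i → i < j → j ≤ i' → i' < j' → j' ≤ S.length + 1 →
    (i' = j ∨ c * Real.logb 2 S.length < (((j - i) + (j' - i') : ℕ) : ℝ)) →
    (ED (substr S i j) (substr S i' j') : ℝ) >
      (1 - ε) * (((j - i) + (j' - i') : ℕ) : ℝ)


theorem exists_lcsLen_eq {α : Type*} [DecidableEq α] (a b : List α) :
    ∃ c : List α, c.Sublist a ∧ c.Sublist b ∧ c.length = lcsLen a b := by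
  have foldr_mem : ∀ l : List ℕ, l.foldr max 0 = 0 ∨ l.foldr max 0 ∈ l := by
    intro l
    induction l with
    | nil => simp
    | cons x l ih => simp only [List.foldr_cons, List.mem_cons]; grind
  obtain h | h : lcsLen a b = 0 ∨ lcsLen a b ∈
      (a.sublists.filter (fun c : List α => decide (c.Sublist b))).map List.length := foldr_mem _
  · exact ⟨[], List.nil_sublist _, List.nil_sublist _, h.symm⟩
  · obtain ⟨c, hc, hlen⟩ := List.mem_map.1 h
    simp only [List.mem_filter, List.mem_sublists, decide_eq_true_eq] at hc
    exact ⟨c, hc.1, hc.2, hlen⟩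

/-- A common subsequence with a substring of `f 0, …, f (n - 1)` is read off a set of positions. -/
theorem exists_finset_of_sublist_substr {α : Type*} {n : ℕ} (f : Fin n → α) {i j : ℕ}
    {c : List α} (hi : 1 ≤ i) (h : c.Sublist (substr (List.ofFn f) i j)) :
    ∃ A : Finset (Fin n), (∀ x ∈ A, i ≤ x.val + 1 ∧ x.val + 1 < j) ∧
      (A.sort (· ≤ ·)).map f = c := by
  rw [substr, List.ofFn_eq_map, ← List.map_drop, ← List.map_take, List.sublist_map_iff] at h
  obtain ⟨l, hl, rfl⟩ := h
  have hsub : l.Sublist (List.finRange n) :=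
    hl.trans ((List.take_sublist _ _).trans (List.drop_sublist _ _))
  have hpair : l.Pairwise (· ≤ ·) := (List.pairwise_le_finRange n).sublist hsub
  have hnodup : l.Nodup := (List.nodup_finRange n).sublist hsub
  refine ⟨l.toFinset, fun x hx => ?_, ?_⟩
  · obtain ⟨t, ht, rfl⟩ := List.getElem_of_mem (hl.subset (List.mem_toFinset.1 hx))
    simp only [List.length_take, List.length_drop, List.length_finRange] at ht
    simp only [List.getElem_take, List.getElem_drop, List.getElem_finRange, Fin.val_cast]
    omega
  · rw [(List.toFinset_sort (· ≤ ·) hnodup).2 hpair]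

/-- The positions in `[s, s + M)`. -/
def window (n s M : ℕ) : Finset (Fin n) :=
  Finset.univ.filter fun x => s ≤ x.val ∧ x.val < s + M

theorem card_window_le (n s M : ℕ) : (window n s M).card ≤ M := by
  have h : (window n s M).card ≤ (Finset.Ico s (s + M)).card :=
    Finset.card_le_card_of_injOn Fin.val (fun x hx => by simpa [window] using hx)
      Fin.val_injective.injOn
  simpa using h

/-- The admissible starting points of the first window for a match of size `m` up to `k`. -/
def offsets (n N k m : ℕ) : Finset ℕ :=
  if n ≤ 2 ^ m then Finset.range n else {k + 1 - 2 * N * m}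

theorem card_offsets_le (n N k m : ℕ) : (offsets n N k m).card ≤ 2 ^ m := by
  unfold offsets
  split_ifs with h
  · simpa using h
  · simpa using Nat.one_le_two_pow

/-- The pairs of disjoint `m`-sets of positions up to `k`, in windows of length `2 * N * m`,
along which a string must not agree. -/
def matchPairs (n N k m : ℕ) : Finset (Finset (Fin n) × Finset (Fin n)) :=
  ((offsets n N k m).biUnion fun s =>
    (window n s (2 * N * m)).powersetCard m ×ˢ
      (window n (k + 1 - 2 * N * m) (2 * N * m)).powersetCard m).filter
    fun p => Disjoint p.1 p.2 ∧ ∀ x ∈ p.1 ∪ p.2, x.val ≤ k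

theorem card_matchPairs_le (n N k m : ℕ) :
    (matchPairs n N k m).card ≤ 2 ^ m * (2 * N * m).choose m ^ 2 := by
  refine (Finset.card_filter_le _ _).trans ((Finset.card_biUnion_le_card_mul _ _
    ((2 * N * m).choose m ^ 2) fun s _ => ?_).trans
      (Nat.mul_le_mul_right _ (card_offsets_le n N k m)))
  rw [Finset.card_product, Finset.card_powersetCard, Finset.card_powersetCard, sq]
  exact Nat.mul_le_mul (Nat.choose_le_choose _ (card_window_le _ _ _))
    (Nat.choose_le_choose _ (card_window_le _ _ _))

theorem choose_two_mul_mul_le {N : ℕ} (hN : 0 < N) (m : ℕ) :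
    ((2 * N * m).choose m : ℝ) ≤ (6 * N) ^ m := by
  have hN' : (0 : ℝ) < N := by exact_mod_cast hN
  have hbinom : ((2 * N * m).choose m : ℝ) * (1 / (2 * N)) ^ m
      ≤ (1 / (2 * N) + 1 : ℝ) ^ (2 * N * m) := by
    rw [add_pow]
    have := Finset.single_le_sum
      (f := fun t => (1 / (2 * N) : ℝ) ^ t * 1 ^ (2 * N * m - t) * ((2 * N * m).choose t : ℝ))
      (s := Finset.range (2 * N * m + 1)) (fun t _ => by positivity) (a := m)
      (Finset.mem_range.2 (by nlinarith))
    simpa [mul_comm] using this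
  have hexp : (1 / (2 * N) + 1 : ℝ) ^ (2 * N) ≤ 3 := by
    calc (1 / (2 * N) + 1 : ℝ) ^ (2 * N) ≤ Real.exp (1 / (2 * N)) ^ (2 * N) := by
          gcongr; exact Real.add_one_le_exp _
      _ = Real.exp 1 := by
          rw [← Real.exp_nat_mul]; congr 1; push_cast; field_simp
      _ ≤ 3 := by linarith [Real.exp_one_lt_d9]
  rw [pow_mul] at hbinom
  have h3 := hbinom.trans (pow_le_pow_left₀ (by positivity) hexp m)
  calc ((2 * N * m).choose m : ℝ)
      = ((2 * N * m).choose m : ℝ) * (1 / (2 * N)) ^ m * (2 * N) ^ m := by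
        rw [mul_assoc (Nat.cast _), ← mul_pow, one_div_mul_cancel (by positivity), one_pow, mul_one]
    _ ≤ 3 ^ m * (2 * N) ^ m := by gcongr
    _ = (6 * N) ^ m := by rw [← mul_pow]; ring

theorem sum_card_matchPairs_le {N : ℕ} (hN : 0 < N) (n k : ℕ) :
    ∑ m ∈ Finset.Icc 1 n, ((matchPairs n N k m).card : ℝ) * (2 / (1152 * (N : ℝ) ^ 3)) ^ m
      ≤ 1 / (4 * (N : ℝ)) := by
  have hN' : (1 : ℝ) ≤ N := by exact_mod_cast hN
  set x : ℝ := 1 / (8 * N) with hx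
  have hx0 : 0 < x := by positivity
  have hx1 : x ≤ 1 / 2 := by
    rw [hx, div_le_div_iff₀ (by positivity) (by norm_num)]; linarith
  have hterm : ∀ m, ((matchPairs n N k m).card : ℝ) * (2 / (1152 * N ^ 3)) ^ m ≤ x ^ m := by
    intro m
    calc ((matchPairs n N k m).card : ℝ) * (2 / (1152 * N ^ 3)) ^ m
        ≤ (2 ^ m * ((6 * N) ^ m) ^ 2) * (2 / (1152 * N ^ 3)) ^ m := by
          gcongr
          refine (Nat.cast_le.2 (card_matchPairs_le n N k m)).trans ?_
          push_cast
          gcongr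
          exact choose_two_mul_mul_le hN m
      _ = x ^ m := by
          rw [← pow_mul, mul_comm m 2, pow_mul, ← mul_pow, ← mul_pow, hx]
          congr 1
          field_simp
          norm_num
  have hgeom : ∀ r : ℕ, ∑ m ∈ Finset.Icc 1 r, x ^ m ≤ 2 * x - 2 * x ^ (r + 1) := by
    intro r
    induction r with
    | zero => simp
    | succ r ih =>
      rw [Finset.sum_Icc_succ_top (by omega)]
      have : x ^ (r + 1 + 1) ≤ x ^ (r + 1) * (1 / 2) := by
        rw [pow_succ x (r + 1)]; gcongr
      linarith
  calc _ ≤ ∑ m ∈ Finset.Icc 1 n, x ^ m := Finset.sum_le_sum fun m _ => hterm m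
    _ ≤ 2 * x := (hgeom n).trans (by linarith [pow_pos hx0 (n + 1)])
    _ = 1 / (4 * N) := by rw [hx]; field_simp; norm_num

/-- `f` reads the same word along the two sets of positions. -/
def Agree {α : Type*} {n : ℕ} (f : Fin n → α) (p : Finset (Fin n) × Finset (Fin n)) : Prop :=
  (p.1.sort (· ≤ ·)).map f = (p.2.sort (· ≤ ·)).map f

theorem Agree.congr {α : Type*} {n : ℕ} {f g : Fin n → α} {p : Finset (Fin n) × Finset (Fin n)}
    (h : ∀ x ∈ p.1 ∪ p.2, f x = g x) (hf : Agree f p) : Agree g p := by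
  have h1 : (p.1.sort (· ≤ ·)).map f = (p.1.sort (· ≤ ·)).map g :=
    List.map_congr_left fun x hx => h x (by simp at hx; simp [hx])
  have h2 : (p.2.sort (· ≤ ·)).map f = (p.2.sort (· ≤ ·)).map g :=
    List.map_congr_left fun x hx => h x (by simp at hx; simp [hx])
  rw [Agree, ← h1, ← h2]
  exact hf

/-- Prescribing agreement along `(A, B)` makes a family that does not look at `B` smaller by a
factor of `q ^ |B|`. -/
theorem card_filter_agree_mul_le {n q : ℕ} {A B : Finset (Fin n)} (hAB : Disjoint A B)
    (G : Finset (Fin n → Fin q))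
    (hG : ∀ f ∈ G, ∀ g : Fin n → Fin q, (∀ x ∉ B, f x = g x) → g ∈ G)
    [DecidablePred fun f : Fin n → Fin q => Agree f (A, B)] :
    (G.filter fun f => Agree f (A, B)).card * q ^ B.card ≤ G.card := by
  have hcard : (Finset.univ : Finset (B → Fin q)).card = q ^ B.card := by simp
  rw [← hcard, ← Finset.card_product]
  refine Finset.card_le_card_of_injOn
    (fun ft x => if hx : x ∈ B then ft.2 ⟨x, hx⟩ else ft.1 x) ?_ ?_
  · rintro ⟨f, t⟩ hft
    simp only [Finset.coe_product, Set.mem_prod, Finset.mem_coe, Finset.mem_filter] at hft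
    exact hG f hft.1.1 _ fun x hx => by simp [hx]
  · rintro ⟨f, t⟩ hf ⟨g, u⟩ hg hfg
    simp only [Finset.coe_product, Set.mem_prod, Finset.mem_coe, Finset.mem_filter] at hf hg
    have hout : ∀ x ∉ B, f x = g x := fun x hx => by simpa [hx] using congrFun hfg x
    have hA : (A.sort (· ≤ ·)).map f = (A.sort (· ≤ ·)).map g :=
      List.map_congr_left fun x hx =>
        hout x (Finset.disjoint_left.1 hAB ((Finset.mem_sort _).1 hx))
    have hB : (B.sort (· ≤ ·)).map f = (B.sort (· ≤ ·)).map g :=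
      hf.1.2.symm.trans (hA.trans hg.1.2)
    refine Prod.ext (funext fun x => ?_) (funext fun x => ?_)
    · by_cases hx : x ∈ B
      · exact List.map_inj_left.1 hB x ((Finset.mem_sort _).2 hx)
      · exact hout x hx
    · simpa using congrFun hfg x.val

open Classical in
/-- The strings that agree along no pair of position sets ending before `k`. -/
noncomputable def goodStrings (n N q k : ℕ) : Finset (Fin n → Fin q) :=
  Finset.univ.filter fun f =>
    ∀ l < k, ∀ m ∈ Finset.Icc 1 n, ∀ p ∈ matchPairs n N l m, ¬ Agree f p

theorem mem_goodStrings_congr {n N q k : ℕ} {f g : Fin n → Fin q}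
    (hf : f ∈ goodStrings n N q k) (h : ∀ x : Fin n, x.val < k → f x = g x) :
    g ∈ goodStrings n N q k := by
  simp only [goodStrings, Finset.mem_filter, Finset.mem_univ, true_and] at hf ⊢
  intro l hl m hm p hp hagree
  refine hf l hl m hm p hp (hagree.congr fun x hx => (h x ?_).symm)
  exact ((Finset.mem_filter.1 hp).2.2 x hx).trans_lt hl

open Classical in
theorem card_goodStrings_le_add {N : ℕ} (hN : 0 < N) (n q k : ℕ) :
    (goodStrings n N q k).card ≤ (goodStrings n N q (k + 1)).card +
      ∑ m ∈ Finset.Icc 1 n, ∑ p ∈ matchPairs n N k m,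
        ((goodStrings n N q (k + 1 - 2 * N * m)).filter fun f => Agree f p).card := by
  have hsub : goodStrings n N q k ⊆ goodStrings n N q (k + 1) ∪
      (Finset.Icc 1 n).biUnion fun m => (matchPairs n N k m).biUnion fun p =>
        (goodStrings n N q (k + 1 - 2 * N * m)).filter fun f => Agree f p := by
    intro f hf
    by_contra hcon
    simp only [Finset.mem_union, Finset.mem_biUnion, not_or, not_exists, not_and,
      Finset.mem_filter] at hcon
    refine hcon.1 ?_
    simp only [goodStrings, Finset.mem_filter, Finset.mem_univ, true_and] at hf ⊢
    intro l hl m hm p hp hagree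
    rcases Nat.lt_succ_iff_lt_or_eq.1 hl with hlk | rfl
    · exact hf l hlk m hm p hp hagree
    · refine hcon.2 m hm p hp ?_ hagree
      simp only [goodStrings, Finset.mem_filter, Finset.mem_univ, true_and]
      have : 1 ≤ 2 * N * m := Nat.mul_pos (by omega) (Finset.mem_Icc.1 hm).1
      exact fun l' hl' => hf l' (by omega)
  refine (Finset.card_le_card hsub).trans ((Finset.card_union_le _ _).trans ?_)
  gcongr
  exact Finset.card_biUnion_le.trans (Finset.sum_le_sum fun m _ => Finset.card_biUnion_le)

theorem card_goodStrings_succ_ge {N : ℕ} (hN : 0 < N) (n k : ℕ) :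
    (1 - 1 / (4 * N) : ℝ) * (goodStrings n N (1152 * N ^ 3) k).card ≤
      (goodStrings n N (1152 * N ^ 3) (k + 1)).card := by
  classical
  induction k using Nat.strong_induction_on with
  | _ k ih =>
  set q : ℕ := 1152 * N ^ 3 with hq
  have hq0 : (0 : ℝ) < q := by rw [hq]; positivity
  have hN' : (1 : ℝ) ≤ N := by exact_mod_cast hN
  set g : ℕ → ℝ := fun l => (goodStrings n N q l).card with hg
  set d : ℝ := 1 - 1 / (4 * N) with hd
  have hd0 : 0 ≤ d := by
    rw [hd, sub_nonneg, div_le_one (by positivity)]; linarith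
  have hd1 : d ≤ 1 := by
    rw [hd]; linarith [show (0 : ℝ) ≤ 1 / (4 * N) by positivity]
  have hgrow : ∀ t l, l + t ≤ k → d ^ t * g l ≤ g (l + t) := by
    intro t
    induction t with
    | zero => simp
    | succ t iht =>
      intro l hl
      calc d ^ (t + 1) * g l = d * (d ^ t * g l) := by ring
        _ ≤ d * g (l + t) := mul_le_mul_of_nonneg_left (iht l (by omega)) hd0
        _ ≤ g (l + (t + 1)) := ih (l + t) (by omega)
  have hhalf : (1 / 2 : ℝ) ≤ d ^ (2 * N) := by
    have := one_add_mul_le_pow (a := -(1 / (4 * N) : ℝ))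
      (by linarith [show 1 / (4 * N : ℝ) ≤ 1 by rw [div_le_one (by positivity)]; linarith])
      (2 * N)
    rw [← sub_eq_add_neg] at this
    refine le_trans (le_of_eq ?_) this
    push_cast
    field_simp
    norm_num
  have hback : ∀ m ∈ Finset.Icc 1 n, g (k + 1 - 2 * N * m) ≤ 2 ^ m * g k := by
    intro m hm
    have hpos : 1 ≤ 2 * N * m := Nat.mul_pos (by omega) (Finset.mem_Icc.1 hm).1
    have hpow : (1 / 2 : ℝ) ^ m ≤ d ^ (k - (k + 1 - 2 * N * m)) := by
      calc (1 / 2 : ℝ) ^ m ≤ (d ^ (2 * N)) ^ m := by gcongr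
        _ = d ^ (2 * N * m) := (pow_mul _ _ _).symm
        _ ≤ _ := pow_le_pow_of_le_one hd0 hd1 (by omega)
    have h1 := hgrow (k - (k + 1 - 2 * N * m)) (k + 1 - 2 * N * m) (by omega)
    rw [Nat.add_sub_cancel' (by omega)] at h1
    have h2 := (mul_le_mul_of_nonneg_right hpow (Nat.cast_nonneg _)).trans h1
    calc g (k + 1 - 2 * N * m) = 2 ^ m * ((1 / 2) ^ m * g (k + 1 - 2 * N * m)) := by
          rw [← mul_assoc, ← mul_pow]; norm_num
      _ ≤ 2 ^ m * g k := mul_le_mul_of_nonneg_left h2 (by positivity)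
  have hpair : ∀ m ∈ Finset.Icc 1 n, ∀ p ∈ matchPairs n N k m,
      (((goodStrings n N q (k + 1 - 2 * N * m)).filter fun f => Agree f p).card : ℝ) ≤
        (2 / q) ^ m * g k := by
    rintro m hm ⟨A, B⟩ hp
    obtain ⟨hmem, hdisj, -⟩ := Finset.mem_filter.1 hp
    obtain ⟨s, -, hs⟩ := Finset.mem_biUnion.1 hmem
    obtain ⟨hBsub, hBcard⟩ := Finset.mem_powersetCard.1 (Finset.mem_product.1 hs).2
    have hle := card_filter_agree_mul_le hdisj (goodStrings n N q (k + 1 - 2 * N * m))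
      fun f hf g hfg => mem_goodStrings_congr hf fun x hx => hfg x fun hxB => by
        have := (Finset.mem_filter.1 (hBsub hxB)).2.1
        omega
    simp only at hBcard
    rw [hBcard] at hle
    have hle' : (((goodStrings n N q (k + 1 - 2 * N * m)).filter
        fun f => Agree f (A, B)).card : ℝ) * q ^ m ≤ g (k + 1 - 2 * N * m) := by
      simp only [hg]
      exact_mod_cast hle
    rw [div_pow, div_mul_eq_mul_div, le_div_iff₀ (by positivity)]
    exact hle'.trans (hback m hm)
  have hstep : g k ≤ g (k + 1) + ∑ m ∈ Finset.Icc 1 n, ∑ p ∈ matchPairs n N k m,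
      (((goodStrings n N q (k + 1 - 2 * N * m)).filter fun f => Agree f p).card : ℝ) := by
    simp only [hg]
    exact_mod_cast card_goodStrings_le_add hN n q k
  have hsum : ∑ m ∈ Finset.Icc 1 n, ∑ p ∈ matchPairs n N k m,
      (((goodStrings n N q (k + 1 - 2 * N * m)).filter fun f => Agree f p).card : ℝ) ≤
        1 / (4 * N) * g k := by
    refine le_trans (Finset.sum_le_sum fun m hm => Finset.sum_le_card_nsmul _ _ _ (hpair m hm)) ?_
    have := mul_le_mul_of_nonneg_right (sum_card_matchPairs_le hN n k)
      (Nat.cast_nonneg (goodStrings n N q k).card)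
    refine le_trans (le_of_eq ?_) this
    rw [Finset.sum_mul]
    refine Finset.sum_congr rfl fun m _ => ?_
    rw [nsmul_eq_mul, hq, mul_assoc]
    push_cast
    rfl
  change d * g k ≤ g (k + 1)
  rw [hd, sub_mul]
  linarith

theorem goodStrings_nonempty {N : ℕ} (hN : 0 < N) (n k : ℕ) :
    (goodStrings n N (1152 * N ^ 3) k).Nonempty := by
  induction k with
  | zero => exact ⟨fun _ => ⟨0, by positivity⟩, by simp [goodStrings]⟩
  | succ k ih =>
    have hN' : (1 : ℝ) ≤ N := by exact_mod_cast hN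
    have hlt : (1 : ℝ) / (4 * N) < 1 := by rw [div_lt_one (by positivity)]; linarith
    have hcard : (0 : ℝ) < (goodStrings n N (1152 * N ^ 3) k).card := by
      exact_mod_cast ih.card_pos
    have := (mul_pos (sub_pos.2 hlt) hcard).trans_le (card_goodStrings_succ_ge hN n k)
    exact Finset.card_pos.1 (by exact_mod_cast this)

theorem longDistSync_of_mem_goodStrings {n N q : ℕ} {f : Fin n → Fin q}
    (hf : f ∈ goodStrings n N q n) {c ε : ℝ} (hε : 0 < ε) (hN : 1 / ε ≤ N) (hc : 2 / ε ≤ c) :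
    LongDistSync c ε (List.ofFn f) := by
  intro i j i' j' hi hij hji' hij' hj' hfar
  rw [List.length_ofFn] at hj' hfar
  by_contra hED
  rw [gt_iff_lt, not_lt] at hED
  set L : ℕ := (j - i) + (j' - i') with hL
  obtain ⟨w, hw1, hw2, hw⟩ :=
    exists_lcsLen_eq (substr (List.ofFn f) i j) (substr (List.ofFn f) i' j')
  have hlen : (substr (List.ofFn f) i j).length + (substr (List.ofFn f) i' j').length = L := by
    simp only [substr, List.length_take, List.length_drop, List.length_ofFn]
    omega
  set m : ℕ := w.length with hm
  have hL0 : (0 : ℝ) < L := by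
    have : 0 < L := by omega
    exact_mod_cast this
  have hLm : ε * L ≤ 2 * m := by
    have h1 : L ≤ ED (substr (List.ofFn f) i j) (substr (List.ofFn f) i' j') + 2 * m := by
      rw [ED, hlen, ← hw]; omega
    have h2 : (L : ℝ) ≤ ED (substr (List.ofFn f) i j) (substr (List.ofFn f) i' j') + 2 * m := by
      exact_mod_cast h1
    linarith
  have hm1 : 1 ≤ m := by
    have h : (0 : ℝ) < m := by linarith [mul_pos hε hL0]
    exact_mod_cast h
  have hLN : L ≤ 2 * N * m := by
    have h1 : (1 : ℝ) ≤ N * ε := by rwa [div_le_iff₀ hε] at hN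
    have h2 : (L : ℝ) ≤ 2 * N * m := by
      calc (L : ℝ) ≤ N * ε * L := le_mul_of_one_le_left hL0.le h1
        _ = N * (ε * L) := by ring
        _ ≤ N * (2 * m) := by gcongr
        _ = 2 * N * m := by ring
    exact_mod_cast h2
  obtain ⟨A, hA, hAw⟩ := exists_finset_of_sublist_substr f hi hw1
  obtain ⟨B, hB, hBw⟩ := exists_finset_of_sublist_substr f (by omega) hw2
  have hAcard : A.card = m := by rw [hm, ← hAw]; simp
  have hBcard : B.card = m := by rw [hm, ← hBw]; simp
  have hoffset : ∃ s ∈ offsets n N (j' - 2) m, A ⊆ window n s (2 * N * m) := by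
    by_cases hn : n ≤ 2 ^ m
    · refine ⟨i - 1, ?_, fun x hx => ?_⟩
      · rw [offsets, if_pos hn, Finset.mem_range]; omega
      · have := hA x hx
        simp only [window, Finset.mem_filter, Finset.mem_univ, true_and]
        omega
    · refine ⟨j' - 2 + 1 - 2 * N * m, ?_, fun x hx => ?_⟩
      · rw [offsets, if_neg hn, Finset.mem_singleton]
      · have hadj : i' = j := by
          refine hfar.resolve_right fun hlog => hn ?_
          have hn0 : (0 : ℝ) < n := by
            have : 0 < n := by omega
            exact_mod_cast this
          have hlog0 : 0 ≤ Real.logb 2 n :=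
            Real.logb_nonneg (by norm_num) (by exact_mod_cast (by omega : 1 ≤ n))
          have h1 : 2 / ε * Real.logb 2 n ≤ L :=
            (mul_le_mul_of_nonneg_right hc hlog0).trans hlog.le
          have h2 : Real.logb 2 n ≤ m := by
            rw [div_mul_eq_mul_div, div_le_iff₀ hε] at h1
            linarith
          rw [Real.logb_le_iff_le_rpow (by norm_num) hn0, Real.rpow_natCast] at h2
          exact_mod_cast h2
        have := hA x hx
        simp only [window, Finset.mem_filter, Finset.mem_univ, true_and]
        omega
  obtain ⟨s, hs, hAs⟩ := hoffset
  have hmn : m ≤ n := by simpa [hAcard] using Finset.card_le_univ A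
  simp only [goodStrings, Finset.mem_filter, Finset.mem_univ, true_and] at hf
  refine hf (j' - 2) (by omega) m (Finset.mem_Icc.2 ⟨hm1, hmn⟩) (A, B) ?_ (hAw.trans hBw.symm)
  refine Finset.mem_filter.2 ⟨Finset.mem_biUnion.2 ⟨s, hs, Finset.mem_product.2
    ⟨Finset.mem_powersetCard.2 ⟨hAs, hAcard⟩, Finset.mem_powersetCard.2 ⟨fun x hx => ?_, hBcard⟩⟩⟩,
    Finset.disjoint_left.2 fun x hxA hxB => ?_, fun x hx => ?_⟩
  · have := hB x hx
    simp only [window, Finset.mem_filter, Finset.mem_univ, true_and]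
    omega
  · have h1 := hA x hxA
    have h2 := hB x hxB
    omega
  · rcases Finset.mem_union.1 hx with hx | hx
    · have := hA x hx
      omega
    · have := hB x hx
      omega

/-- There is a constant `K > 0` such that for every `0 < ε < 1/K` and every `n`,
a `(K/ε)`-long-distance `ε`-synchronization string of length `n` exists over an
alphabet of size at most `K·ε⁻⁴`. -/
theorem stmt_2 :
    ∃ K : ℝ, 0 < K ∧ ∀ ε : ℝ, 0 < ε → ε < 1 / K → ∀ n : ℕ, 0 < n →
      ∃ (m : ℕ) (S : List (Fin m)),
        (m : ℝ) ≤ K / ε ^ 4 ∧ S.length = n ∧ LongDistSync (K / ε) ε S := by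
  refine ⟨10000, by norm_num, fun ε hε hε1 n _ => ?_⟩
  set N : ℕ := ⌈1 / ε⌉₊ with hN
  have hε1' : ε < 1 := hε1.trans (by norm_num)
  have hN0 : 0 < N := Nat.ceil_pos.2 (by positivity)
  have hceil : (N : ℝ) ≤ 2 / ε := by
    have h1 := Nat.ceil_lt_add_one (show 0 ≤ 1 / ε by positivity)
    have h2 : 1 ≤ 1 / ε := by rw [le_div_iff₀ hε]; linarith
    calc (N : ℝ) ≤ 1 / ε + 1 / ε := by linarith
      _ = 2 / ε := by ring
  obtain ⟨f, hf⟩ := goodStrings_nonempty hN0 n n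
  refine ⟨1152 * N ^ 3, List.ofFn f, ?_, List.length_ofFn,
    longDistSync_of_mem_goodStrings hf hε (Nat.le_ceil _) (by gcongr; norm_num)⟩
  push_cast
  calc (1152 * (N : ℝ) ^ 3) ≤ 1152 * (2 / ε) ^ 3 := by gcongr
    _ = 9216 * ε / ε ^ 4 := by field_simp; norm_num
    _ ≤ 10000 / ε ^ 4 := by gcongr; linarith
end

section
/- Fix an even positive integer n, a real ε with 0 < ε < 1, and a real γ > 0 such that γ·n is a positive integer. Let S ∈ Σⁿ be an ε-synchronization string. Define the string S' of length γ·n² over the alphabet Σ³ by S'[i] = (S[i mod n], S[(i + n/2) mod n], S[⌈i/(γn)⌉]) for 1 ≤ i ≤ γn², where 'a mod n' denotes the representative of a modulo n lying in {1,…,n}. Then S' is an (ε + 6γ)-synchronization string of length γ·n². -/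
/-- `S` is an `ε`-synchronization string: for all positions `1 ≤ i < j < k ≤ |S| + 1`,
`ED(S[i,j), S[j,k)) > (1-ε)·(k-i)`. -/
def SyncString {α : Type*} [DecidableEq α] (ε : ℝ) (S : List α) : Prop :=
  ∀ i j k : ℕ, 1 ≤ i → i < j → j < k → k ≤ S.length + 1 →
    (ED (substr S i j) (substr S j k) : ℝ) > (1 - ε) * ((k - i : ℕ) : ℝ)


/-- `mod1 a n` is the representative of `a` modulo `n` lying in `{1, …, n}`. -/
def mod1 (a n : ℕ) : ℕ := (a - 1) % n + 1

theorem lcsLen_le {α : Type*} [DecidableEq α] {a b : List α} {N : ℕ}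
    (h : ∀ c : List α, c.Sublist a → c.Sublist b → c.length ≤ N) : lcsLen a b ≤ N := by
  have key : ∀ l : List ℕ, (∀ x ∈ l, x ≤ N) → l.foldr max 0 ≤ N := by
    intro l hl
    induction l with
    | nil => simp
    | cons x l ih => simp_all
  refine key _ fun x hx => ?_
  simp only [List.mem_map, List.mem_filter, List.mem_sublists, decide_eq_true_eq] at hx
  obtain ⟨c, ⟨hca, hcb⟩, rfl⟩ := hx
  exact h c hca hcb

theorem length_le_lcsLen {α : Type*} [DecidableEq α] {a b c : List α}
    (ha : c.Sublist a) (hb : c.Sublist b) : c.length ≤ lcsLen a b := by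
  have key : ∀ l : List ℕ, ∀ x ∈ l, x ≤ l.foldr max 0 := by
    intro l
    induction l with
    | nil => simp
    | cons y l ih =>
      intro x hx
      rcases List.mem_cons.1 hx with rfl | hx
      · simp
      · exact (ih x hx).trans (by simp)
  refine key _ _ (List.mem_map.2 ⟨c, ?_, rfl⟩)
  simpa [List.mem_filter] using ⟨ha, hb⟩

theorem lcsLen_le_left {α : Type*} [DecidableEq α] (a b : List α) : lcsLen a b ≤ a.length :=
  lcsLen_le fun _ ha _ => ha.length_le

theorem lcsLen_le_right {α : Type*} [DecidableEq α] (a b : List α) : lcsLen a b ≤ b.length :=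
  lcsLen_le fun _ _ hb => hb.length_le

theorem lcsLen_le_lcsLen_map {α β : Type*} [DecidableEq α] [DecidableEq β] (p : α → β)
    (a b : List α) : lcsLen a b ≤ lcsLen (a.map p) (b.map p) :=
  lcsLen_le fun c ha hb => by simpa using length_le_lcsLen (ha.map p) (hb.map p)

theorem ED_cast {α : Type*} [DecidableEq α] (a b : List α) :
    (ED a b : ℝ) = a.length + b.length - 2 * lcsLen a b := by
  have h1 := lcsLen_le_left a b
  have h2 := lcsLen_le_right a b
  rw [ED, Nat.cast_sub (by omega)]
  push_cast
  rfl

theorem length_substr {α : Type*} {S : List α} {i j : ℕ} (hi : 1 ≤ i) (hj : j ≤ S.length + 1) :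
    (substr S i j).length = j - i := by
  simp only [substr, List.length_take, List.length_drop]
  omega

theorem map_substr {α β : Type*} (p : α → β) (S : List α) (i j : ℕ) :
    (substr S i j).map p = substr (S.map p) i j := by
  simp [substr, List.map_take, List.map_drop]

theorem getElem_substr {α : Type*} (S : List α) (i j u : ℕ) (hu : u < (substr S i j).length)
    (h : i - 1 + u < S.length) : (substr S i j)[u] = S[i - 1 + u] := by
  simp [substr]

/-- The inequality defining synchronization strings, in terms of common subsequences. -/
theorem ED_substr_gt_iff {α : Type*} [DecidableEq α] {S : List α} {i j k : ℕ} (δ : ℝ)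
    (hi : 1 ≤ i) (hij : i ≤ j) (hjk : j ≤ k) (hk : k ≤ S.length + 1) :
    (ED (substr S i j) (substr S j k) : ℝ) > (1 - δ) * ((k - i : ℕ) : ℝ) ↔
      2 * (lcsLen (substr S i j) (substr S j k) : ℝ) < δ * ((k - i : ℕ) : ℝ) := by
  rw [ED_cast, length_substr hi (by omega), length_substr (by omega) hk]
  have : ((j - i : ℕ) : ℝ) + ((k - j : ℕ) : ℝ) = ((k - i : ℕ) : ℝ) := by
    rw [← Nat.cast_add]
    congr 1
    omega
  rw [this]
  constructor <;> intro h <;> linarith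

theorem SyncString.two_mul_lcsLen_le {α : Type*} [DecidableEq α] {ε : ℝ} {S : List α}
    (hS : SyncString ε S) (hε : 0 ≤ ε) {i j k : ℕ} (hi : 1 ≤ i) (hij : i ≤ j) (hjk : j ≤ k)
    (hk : k ≤ S.length + 1) :
    2 * (lcsLen (substr S i j) (substr S j k) : ℝ) ≤ ε * ((k - i : ℕ) : ℝ) := by
  have h1 := lcsLen_le_left (substr S i j) (substr S j k)
  have h2 := lcsLen_le_right (substr S i j) (substr S j k)
  rw [length_substr hi (by omega)] at h1
  rw [length_substr (by omega) hk] at h2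
  by_cases h : i < j ∧ j < k
  · exact ((ED_substr_gt_iff ε hi hij hjk hk).1 (hS i j k hi h.1 h.2 hk)).le
  · have : lcsLen (substr S i j) (substr S j k) = 0 := by omega
    rw [this]
    simp only [Nat.cast_zero, mul_zero]
    positivity

theorem map_range_sublist_substr {α : Type*} [Inhabited α] {S : List α} {i j q : ℕ} {h : ℕ → ℕ}
    (hj : j ≤ S.length) (hlo : ∀ t < q, i ≤ h t) (hhi : ∀ t < q, h t < j)
    (hmono : ∀ t u, t < u → u < q → h t < h u) :
    ((List.range q).map fun t => S.getD (h t) default).Sublist (substr S (i + 1) (j + 1)) := by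
  have hlen : (substr S (i + 1) (j + 1)).length = j - i := by
    rw [length_substr] <;> omega
  rw [List.sublist_iff_exists_fin_orderEmbedding_get_eq]
  suffices H : ∃ φ : Fin ((List.range q).map fun t => S.getD (h t) default).length ↪o
      Fin (substr S (i + 1) (j + 1)).length, ∀ t, (φ t : ℕ) = h t - i by
    obtain ⟨φ, hφ⟩ := H
    refine ⟨φ, fun t => ?_⟩
    have ht : (t : ℕ) < q := by simpa using t.2
    have h1 := hlo t ht
    have h2 := hhi t ht
    have h3 := hφ t
    simp only [List.get_eq_getElem, List.getElem_map, List.getElem_range]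
    rw [getElem_substr _ _ _ _ _ (by omega), List.getD_eq_getElem _ _ (by omega)]
    congr 1
    omega
  refine ⟨OrderEmbedding.ofStrictMono (fun t => ⟨h t - i, ?_⟩) ?_, fun t => rfl⟩
  · have ht : (t : ℕ) < q := by simpa using t.2
    have := hlo t ht
    have := hhi t ht
    omega
  · intro t u htu
    have hu : (u : ℕ) < q := by simpa using u.2
    have htu' : (t : ℕ) < u := htu
    have := hlo t (htu'.trans hu)
    have := hmono t u htu' hu
    simp only [Fin.mk_lt_mk]
    omega

theorem exists_index_of_sublist_substr {α : Type*} {S w : List α} {i j : ℕ}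
    (hj : j ≤ S.length) (hc : w.Sublist (substr S (i + 1) (j + 1))) :
    ∃ f : ℕ → ℕ, StrictMono f ∧ (∀ t, i ≤ f t) ∧ (∀ t < w.length, f t < j) ∧
      ∀ t < w.length, w[t]? = S[f t]? := by
  obtain ⟨e, he⟩ := List.sublist_iff_exists_orderEmbedding_getElem?_eq.1 hc
  have hlen : (substr S (i + 1) (j + 1)).length = j - i := by
    rw [length_substr] <;> omega
  have hlt : ∀ t < w.length, e t < j - i := by
    intro t ht
    by_contra hcon
    have := he t
    rw [List.getElem?_eq_getElem ht, List.getElem?_eq_none (by omega)] at this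
    exact absurd this (by simp)
  refine ⟨fun t => i + e t, fun t u htu => by simpa using e.strictMono htu, fun t => by simp,
    fun t ht => ?_, fun t ht => ?_⟩
  · have := hlt t ht
    dsimp only
    omega
  · have := hlt t ht
    dsimp only
    rw [he t, List.getElem?_eq_getElem (by omega), List.getElem?_eq_getElem (by omega),
      getElem_substr _ _ _ _ _ (by omega)]
    simp

/-- A window of the periodic repetition of `S` avoiding the period boundaries is a substring
of `S`. -/
theorem substr_periodic {α : Type*} [Inhabited α] {S : List α} {N h q i j : ℕ}
    (hi : 1 ≤ i) (hj : j ≤ N + 1) (hlo : q * S.length ≤ i - 1 + h)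
    (hhi : j - 1 + h ≤ (q + 1) * S.length) :
    substr ((List.range N).map fun t => S.getD ((t + h) % S.length) default) i j =
      substr S (i + h - q * S.length) (j + h - q * S.length) := by
  rw [add_mul, one_mul] at hhi
  rcases Nat.lt_or_ge i j with hij | hij
  swap
  · simp [substr, Nat.sub_eq_zero_of_le hij,
      Nat.sub_eq_zero_of_le (show j + h - q * S.length ≤ i + h - q * S.length by omega)]
  have hl1 : (substr ((List.range N).map fun t => S.getD ((t + h) % S.length) default) i j).length
      = j - i := length_substr hi (by simpa using hj)
  have hl2 : (substr S (i + h - q * S.length) (j + h - q * S.length)).length = j - i := by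
    rw [length_substr] <;> omega
  refine List.ext_getElem (by rw [hl1, hl2]) fun u hu1 hu2 => ?_
  rw [hl1] at hu1
  rw [getElem_substr _ _ _ _ _ (by simp; omega), getElem_substr _ _ _ _ _ (by omega)]
  simp only [List.getElem_map, List.getElem_range]
  have hmod : (i - 1 + u + h) % S.length = i + h - q * S.length - 1 + u := by
    rw [show i - 1 + u + h = (i + h - q * S.length - 1 + u) + S.length * q by
      rw [mul_comm S.length]; omega, Nat.add_mul_mod_self_left, Nat.mod_eq_of_lt (by omega)]
  rw [hmod, List.getD_eq_getElem]

/-- Repeating every symbol of a string `m` times multiplies the common subsequences of adjacent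
substrings by at most `m`, up to the block containing the split point. -/
theorem exists_lcsLen_stretch_le {α : Type*} [DecidableEq α] [Inhabited α] {S : List α}
    {m i j k : ℕ} (hm : 0 < m) (hij : i ≤ j) (hjk : j < k) (hk : k ≤ m * S.length) :
    ∃ a s b, a ≤ s ∧ s ≤ b ∧ b ≤ S.length ∧ m * (b - a) + 2 ≤ k - i + 2 * m ∧
      2 * lcsLen
          (substr ((List.range (m * S.length)).map fun t => S.getD (t / m) default) (i + 1) (j + 1))
          (substr ((List.range (m * S.length)).map fun t => S.getD (t / m) default) (j + 1) (k + 1))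
        ≤ m + m * (2 * lcsLen (substr S (a + 1) (s + 1)) (substr S (s + 1) (b + 1))) := by
  set T := (List.range (m * S.length)).map fun t => S.getD (t / m) default with hT
  have hTlen : T.length = m * S.length := by simp [hT]
  have hTget : ∀ x < m * S.length, T[x]? = some (S.getD (x / m) default) := by
    intro x hx
    simp [hT, hx]
  obtain ⟨a, ha⟩ : ∃ a, a = i / m := ⟨_, rfl⟩
  obtain ⟨s, hs⟩ : ∃ s, s = (j + m / 2) / m := ⟨_, rfl⟩
  obtain ⟨b, hb⟩ : ∃ b, b = (k + m - 1) / m := ⟨_, rfl⟩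
  have has : a ≤ s := ha ▸ hs ▸ Nat.div_le_div_right (by omega)
  have hsb : s ≤ b := hs ▸ hb ▸ Nat.div_le_div_right (by omega)
  have hbS : b ≤ S.length := by
    rw [hb, ← Nat.lt_succ_iff, Nat.div_lt_iff_lt_mul hm, Nat.succ_mul, mul_comm S.length]
    omega
  have ha1 : m * a ≤ i := ha ▸ Nat.mul_div_le i m
  have ha2 : i < m * a + m := by rw [ha, mul_comm]; exact Nat.lt_div_mul_add hm
  have hb1 : m * b ≤ k + m - 1 := hb ▸ Nat.mul_div_le _ m
  have hb2 : k + m - 1 < m * b + m := by rw [hb, mul_comm]; exact Nat.lt_div_mul_add hm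
  have hs1 : m * s ≤ j + m / 2 := hs ▸ Nat.mul_div_le _ m
  have hs2 : j + m / 2 < m * s + m := by rw [hs, mul_comm]; exact Nat.lt_div_mul_add hm
  refine ⟨a, s, b, has, hsb, hbS, by rw [Nat.mul_sub]; omega, ?_⟩
  obtain ⟨M, hM⟩ : ∃ M, M = lcsLen (substr S (a + 1) (s + 1)) (substr S (s + 1) (b + 1)) :=
    ⟨_, rfl⟩
  suffices h : lcsLen (substr T (i + 1) (j + 1)) (substr T (j + 1) (k + 1)) ≤ m / 2 + m * M by
    rw [← hM, Nat.mul_left_comm]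
    omega
  refine lcsLen_le fun c hcl hcr => ?_
  obtain ⟨f, hf, hfi, hfj, hfc⟩ := exists_index_of_sublist_substr (by omega) hcl
  obtain ⟨g, hg, hgj, hgk, hgc⟩ := exists_index_of_sublist_substr (by omega) hcr
  -- A long run of matched pairs staying on the correct sides of the block boundary `m * s`.
  obtain ⟨o, e, hoe, hlen, hfs, hgs⟩ : ∃ o e, o + e ≤ c.length ∧ c.length ≤ m / 2 + e ∧
      (∀ u, o ≤ u → u < o + e → f u < m * s) ∧ (∀ u, o ≤ u → u < o + e → m * s ≤ g u) := by
    rcases le_total (m * s) j with h | h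
    · refine ⟨0, c.length - (j - m * s), by omega, by omega, fun u _ hu => ?_, fun u _ _ => ?_⟩
      · have h1 := hf.add_le_nat (c.length - 1 - u) u
        have h2 := hfj (c.length - 1) (by omega)
        rw [show c.length - 1 - u + u = c.length - 1 by omega] at h1
        omega
      · exact h.trans (hgj u)
    · by_cases hc : m * s - j ≤ c.length
      · refine ⟨m * s - j, c.length - (m * s - j), by omega, by omega, fun u _ hu => ?_,
          fun u hu _ => ?_⟩
        · exact (hfj u (by omega)).trans_le h
        · have h1 := hg.add_le_nat u 0
          have h2 := hgj 0
          rw [add_zero] at h1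
          omega
      · exact ⟨0, 0, by omega, by omega, by omega, by omega⟩
  obtain ⟨q, hq⟩ : ∃ q, q = (e + m - 1) / m := ⟨_, rfl⟩
  have hq1 : m * q ≤ e + m - 1 := hq ▸ Nat.mul_div_le _ m
  have hq2 : e + m - 1 < m * q + m := by rw [hq, mul_comm]; exact Nat.lt_div_mul_add hm
  have hidx : ∀ t < q, o + m * t < o + e := by
    intro t ht
    have := Nat.mul_le_mul_left m (Nat.succ_le_of_lt ht)
    rw [Nat.mul_succ] at this
    omega
  have hblock : ∀ F : ℕ → ℕ, StrictMono F → ∀ t u, t < u → u < q →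
      F (o + m * t) / m < F (o + m * u) / m := by
    intro F hF t u htu _
    have h1 := Nat.mul_le_mul_left m (Nat.succ_le_of_lt htu)
    rw [Nat.mul_succ] at h1
    have h2 := hF.add_le_nat m (o + m * t)
    have h3 := hF.monotone (show m + (o + m * t) ≤ o + m * u by omega)
    have h4 := Nat.div_le_div_right (c := m) (show F (o + m * t) + m ≤ F (o + m * u) by omega)
    rwa [Nat.add_div_right _ hm] at h4
  have hsub1 : ((List.range q).map fun t => S.getD (f (o + m * t) / m) default).Sublist
      (substr S (a + 1) (s + 1)) := by
    refine map_range_sublist_substr (h := fun t => f (o + m * t) / m) (by omega) (fun t _ => ?_)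
      (fun t ht => ?_) (hblock f hf)
    · exact ha ▸ Nat.div_le_div_right (hfi _)
    · rw [Nat.div_lt_iff_lt_mul hm, mul_comm s]
      exact hfs _ (by omega) (hidx t ht)
  have hsub2 : ((List.range q).map fun t => S.getD (g (o + m * t) / m) default).Sublist
      (substr S (s + 1) (b + 1)) := by
    refine map_range_sublist_substr (h := fun t => g (o + m * t) / m) (by omega) (fun t ht => ?_)
      (fun t ht => ?_) (hblock g hg)
    · rw [Nat.le_div_iff_mul_le hm, mul_comm s]
      exact hgs _ (by omega) (hidx t ht)
    · have := hidx t ht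
      have := hgk (o + m * t) (by omega)
      rw [Nat.div_lt_iff_lt_mul hm, mul_comm b]
      omega
  have heq : ((List.range q).map fun t => S.getD (f (o + m * t) / m) default) =
      (List.range q).map fun t => S.getD (g (o + m * t) / m) default := by
    refine List.map_congr_left fun t ht => ?_
    have h0 := hidx t (List.mem_range.1 ht)
    have h1 := hfj (o + m * t) (by omega)
    have h2 := hgk (o + m * t) (by omega)
    have h3 := (hfc (o + m * t) (by omega)).symm.trans (hgc (o + m * t) (by omega))
    rw [hTget _ (by omega), hTget _ (by omega)] at h3
    exact Option.some.inj h3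
  have hqM : q ≤ M := by
    simpa [hM] using length_le_lcsLen hsub1 (heq ▸ hsub2)
  have := Nat.mul_le_mul_left m hqM
  omega

/-- A window of at most `n / 2` positions avoids the multiples of `n`, possibly after a shift
by `n / 2`. -/
theorem exists_shift_avoiding_boundary {n i k : ℕ} (hn : 0 < n) (hik : i ≤ k)
    (hk : 2 * (k - i) ≤ n) (he : Even n) :
    ∃ h, (h = 0 ∨ h = n / 2) ∧ ∃ q, q * n ≤ i + h ∧ k + h ≤ (q + 1) * n := by
  have h2 := Nat.even_iff.1 he
  have h3 := Nat.div_mul_le_self i n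
  have h4 := Nat.lt_div_mul_add (a := i) hn
  by_cases h : k ≤ (i / n + 1) * n
  · exact ⟨0, Or.inl rfl, i / n, by omega, by omega⟩
  · refine ⟨n / 2, Or.inr rfl, i / n + 1, ?_, ?_⟩ <;> simp only [add_mul, one_mul] at * <;> omega

/-- Boosting step: from an `ε`-synchronization string `S` of even length `n`, the
string `S'` of length `γn²` over `Σ³` with
`S'[i] = (S[i mod n], S[(i + n/2) mod n], S[⌈i/(γn)⌉])` is an
`(ε + 6γ)`-synchronization string. (Here `m = γ·n ∈ ℕ`, and 1-based indexing is used.) -/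
theorem stmt_3 {α : Type*} [DecidableEq α] [Inhabited α]
    (n : ℕ) (hn : 0 < n) (hneven : Even n)
    (ε γ : ℝ) (hε0 : 0 < ε) (hε1 : ε < 1) (hγ : 0 < γ)
    (m : ℕ) (hm : 0 < m) (hmγ : (m : ℝ) = γ * n)
    (S : List α) (hS : S.length = n) (hsync : SyncString ε S)
    (S' : List (α × α × α))
    (hS' : S' = (List.range (m * n)).map (fun t =>
      (S.getD (mod1 (t + 1) n - 1) default,
       S.getD (mod1 (t + 1 + n / 2) n - 1) default,
       S.getD ((t + 1 + m - 1) / m - 1) default))) :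
    (S'.length : ℝ) = γ * n ^ 2 ∧ SyncString (ε + 6 * γ) S' := by
  subst hS
  have hproj1 : S'.map (fun x => x.1) =
      (List.range (m * S.length)).map fun t => S.getD ((t + 0) % S.length) default := by
    simp [hS', mod1]
  have hproj2 : S'.map (fun x => x.2.1) =
      (List.range (m * S.length)).map fun t => S.getD ((t + S.length / 2) % S.length) default := by
    simp only [hS', mod1, List.map_map]
    refine List.map_congr_left fun t _ => ?_
    simp only [Function.comp_apply]
    rw [Nat.add_sub_cancel, show t + 1 + S.length / 2 - 1 = t + S.length / 2 by omega]
  have hproj3 : S'.map (fun x => x.2.2) =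
      (List.range (m * S.length)).map fun t => S.getD (t / m) default := by
    simp only [hS', List.map_map]
    refine List.map_congr_left fun t _ => ?_
    simp only [Function.comp_apply]
    rw [show t + 1 + m - 1 = t + m by omega, Nat.add_div_right _ hm, Nat.succ_sub_one]
  have hlen : S'.length = m * S.length := by simp [hS']
  refine ⟨by rw [hlen, Nat.cast_mul, hmγ]; ring, fun i j k hi hij hjk hk => ?_⟩
  rw [ED_substr_gt_iff _ hi hij.le hjk.le hk]
  rw [hlen] at hk
  have hl : (0 : ℝ) < ((k - i : ℕ) : ℝ) := by
    exact_mod_cast (by omega : 0 < k - i)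
  rcases Nat.lt_or_ge S.length (2 * (k - i)) with hlong | hshort
  · obtain ⟨i, rfl⟩ := Nat.exists_eq_add_of_le' hi
    obtain ⟨j, rfl⟩ := Nat.exists_eq_add_of_le' (hi.trans hij.le)
    obtain ⟨k, rfl⟩ := Nat.exists_eq_add_of_le' (hi.trans (hij.trans hjk).le)
    obtain ⟨a, s, b, has, hsb, hb, hab, hle⟩ := exists_lcsLen_stretch_le (S := S) (i := i) (j := j)
      (k := k) hm (by omega) (by omega) (by omega)
    have hS2 := hsync.two_mul_lcsLen_le hε0.le (i := a + 1) (j := s + 1) (k := b + 1)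
      (by omega) (by omega) (by omega) (by omega)
    have hp := lcsLen_le_lcsLen_map (fun x : α × α × α => x.2.2) (substr S' (i + 1) (j + 1))
      (substr S' (j + 1) (k + 1))
    rw [map_substr, map_substr, hproj3] at hp
    have hle' := (Nat.mul_le_mul_left 2 hp).trans hle
    rw [Nat.add_sub_add_right] at hS2 hlong hl ⊢
    have h1 := (Nat.cast_le (α := ℝ)).2 hle'
    have h2 := (Nat.cast_le (α := ℝ)).2 hab
    have h3 := (Nat.cast_lt (α := ℝ)).2 hlong
    push_cast at h1 h2 h3
    have hm' : (0 : ℝ) < m := by exact_mod_cast hm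
    have hm1 : (1 : ℝ) ≤ m := by exact_mod_cast hm
    have h4 := mul_le_mul_of_nonneg_left hS2 hm'.le
    have h5 := mul_le_mul_of_nonneg_left h2 hε0.le
    have h6 := mul_lt_mul_of_pos_left h3 hγ
    have h7 : ε * m ≤ m := by nlinarith
    nlinarith
  · obtain ⟨h, hh, q, hq1, hq2⟩ := exists_shift_avoiding_boundary (i := i - 1) (k := k - 1) hn
      (by omega) (by omega) hneven
    obtain ⟨p, hp⟩ : ∃ p : α × α × α → α, S'.map p =
        (List.range (m * S.length)).map fun t => S.getD ((t + h) % S.length) default := by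
      rcases hh with rfl | rfl
      exacts [⟨_, hproj1⟩, ⟨_, hproj2⟩]
    have hle := lcsLen_le_lcsLen_map p (substr S' i j) (substr S' j k)
    rw [map_substr, map_substr, hp, substr_periodic hi (by omega) hq1 (by omega),
      substr_periodic (by omega) hk (by omega) hq2] at hle
    rw [add_mul, one_mul] at hq2
    have hS1 := hsync (i + h - q * S.length) (j + h - q * S.length) (k + h - q * S.length)
      (by omega) (by omega) (by omega) (by omega)
    rw [ED_substr_gt_iff _ (by omega) (by omega) (by omega) (by omega),
      show k + h - q * S.length - (i + h - q * S.length) = k - i by omega] at hS1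
    have hle' := (Nat.cast_le (α := ℝ)).2 hle
    nlinarith [mul_pos hγ hl]
end
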